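/- For every integer n with 2 ≤ n ≤ 104, s(n) equals the minimum of s(p) taken over all prime numbers p dividing n. -/

import Mathlib

/-- A squared tiling of the `n × n` square: a finite set of triples `(x, y, h)`
representing an `h × h` square with upper-left corner at cell `(x, y)`,
where `1 ≤ h ≤ n - 1`, the square lies inside the board, and every cell
`(i, j)` with `i, j < n` is covered by exactly one square of the tiling. -/
def IsSquaredTiling (n : ℕ) (T : Finset (ℕ × ℕ × ℕ)) : Prop :=
  (∀ t ∈ T, 1 ≤ t.2.2 ∧ t.2.2 ≤ n - 1 ∧ t.1 + t.2.2 ≤ n ∧ t.2.1 + t.2.2 ≤ n) ∧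
  (∀ i j : ℕ, i < n → j < n →
    ∃! t : ℕ × ℕ × ℕ, t ∈ T ∧
      t.1 ≤ i ∧ i < t.1 + t.2.2 ∧ t.2.1 ≤ j ∧ j < t.2.1 + t.2.2)

/-- `s n` is the minimum number of squares in a squared tiling of the
`n × n` square. -/
noncomputable def s (n : ℕ) : ℕ :=
  sInf {k | ∃ T : Finset (ℕ × ℕ × ℕ), IsSquaredTiling n T ∧ T.card = k}

noncomputable section

def bi {α : Type} (b : Bool) (x y : α) : α := Bool.rec (motive := fun _ => α) y x b

def frc {α : Type} (x : ℕ) (f : ℕ → α) : α :=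
  Nat.rec (motive := fun _ => α) (f 0) (fun k _ => f (Nat.succ k)) x

def mcons (h w : ℕ) (S : List (ℕ × ℕ)) (k : List (ℕ × ℕ) → Bool) : Bool :=
  Nat.rec (motive := fun _ => Bool) (k S) (fun _ _ =>
    List.rec (motive := fun _ => Bool) (k [(h, w)])
      (fun p S' _ => Prod.rec (motive := fun _ => Bool) (fun h' v =>
        bi (Nat.beq h h') (frc (Nat.add w v) (fun u => k ((h, u) :: S')))
          (k ((h, w) :: p :: S'))) p) S) w

def place (m a : ℕ) (S : List (ℕ × ℕ)) : (List (ℕ × ℕ) → Bool) → Bool :=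
  List.rec (motive := fun _ => (List (ℕ × ℕ) → Bool) → Bool) (fun k => k [])
    (fun p S' ih k => Prod.rec (motive := fun _ => Bool) (fun h w =>
      bi (Nat.beq h m)
        (frc (Nat.sub w a) (fun u => mcons m u S'
          (fun S1 => frc (Nat.add m a) (fun v => mcons v a S1 k))))
        (ih (fun S1 => mcons h w S1 k))) p) S

def memb (v : ℕ) (l : List ℕ) : Bool :=
  List.rec (motive := fun _ => Bool) false (fun a _ ih => bi (Nat.beq v a) true ih) l

def hsK (n : ℕ) (S : List (ℕ × ℕ)) : (List ℕ → Bool) → Bool :=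
  List.rec (motive := fun _ => (List ℕ → Bool) → Bool) (fun k => k [])
    (fun p _ ih k => Prod.rec (motive := fun _ => Bool) (fun h _ =>
      bi (Nat.ble n h) (ih k)
      (ih (fun hs => bi (memb h hs) (k hs) (k (h :: hs))))) p) S

def lmin (l : List ℕ) : ℕ → ℕ :=
  List.rec (motive := fun _ => ℕ → ℕ) (fun v => v)
    (fun a _ ih v => bi (Nat.ble a v) (ih a) (ih v)) l

def len (l : List ℕ) : ℕ :=
  List.rec (motive := fun _ => ℕ) Nat.zero (fun _ _ ih => Nat.succ ih) l

def runK (m : ℕ) (S : List (ℕ × ℕ)) : ℕ → (ℕ → ℕ → Bool) → Bool :=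
  List.rec (motive := fun _ => ℕ → (ℕ → ℕ → Bool) → Bool) (fun _ _ => true)
    (fun p _ ih x k => Prod.rec (motive := fun _ => Bool) (fun h w =>
      bi (Nat.beq h m) (k x w) (frc (Nat.add x w) (fun x' => ih x' k))) p) S

def anyBelow (f : ℕ → Bool) (k : ℕ) : Bool :=
  Nat.rec (motive := fun _ => Bool) false (fun k ih => bi (f k) true ih) k

def anyL (f : ℕ → Bool) (l : List ℕ) : Bool :=
  List.rec (motive := fun _ => Bool) false (fun a _ ih => bi (f a) true ih) l

def tryA (n : ℕ) (ok : ℕ → ℕ → ℕ → Bool) (rec : List (ℕ × ℕ) → Bool) (S : List (ℕ × ℕ))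
    (m x a : ℕ) : Bool :=
  bi (Nat.ble (Nat.add m a) n) (bi (ok x m a) (place m a S rec) false) false

def stepB (n : ℕ) (r : ℕ) (tr : ℕ → Bool) (m l : ℕ) (hs : List ℕ) (w : ℕ) : Bool :=
  bi (tr w) true
  (bi (Nat.ble (Nat.succ r) l) false
  (bi (Nat.ble r l)
    (anyL (fun v => bi (Nat.ble (Nat.add m w) v) false
      (bi (Nat.ble v m) false (frc (Nat.sub v m) tr))) (n :: hs))
  (bi (Nat.ble r (Nat.succ l))
    (bi (anyL (fun v => bi (Nat.ble (Nat.add m w) v) false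
      (bi (Nat.ble v m) false
      (bi (frc (Nat.sub v m) tr) true
        (frc (Nat.sub w (Nat.sub v m)) tr)))) (n :: hs)) true
    (frc (Nat.div w 2) (fun u => bi (Nat.beq (Nat.add u u) w) (tr u) false)))
  (anyBelow (fun k => tr (Nat.succ k)) (Nat.pred w)))))

def stepA (n : ℕ) (ok : ℕ → ℕ → ℕ → Bool) (r : ℕ) (rec : List (ℕ × ℕ) → Bool)
    (S : List (ℕ × ℕ)) (hs : List ℕ) : Bool :=
  frc (len hs) (fun l =>
  bi (Nat.beq l 0) true
  (bi (Nat.ble l (Nat.succ r))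
    (frc (lmin hs n) (fun m => runK m S 0 (fun x w => stepB n r (tryA n ok rec S m x) m l hs w)))
    false))

def search (n : ℕ) (ok : ℕ → ℕ → ℕ → Bool) (r : ℕ) : List (ℕ × ℕ) → Bool :=
  Nat.rec (motive := fun _ => List (ℕ × ℕ) → Bool)
    (fun S => hsK n S (fun hs => Nat.beq (len hs) 0))
    (fun r ih S => hsK n S (stepA n ok r ih S)) r

def okAll : ℕ → ℕ → ℕ → Bool := fun _ _ _ => true
def okBd (n : ℕ) : ℕ → ℕ → ℕ → Bool := fun x y a =>
  bi (Nat.beq x 0) true (bi (Nat.beq (Nat.add x a) n) true (Nat.beq (Nat.add y a) n))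

def chk2 (n r : ℕ) : Bool :=
  anyBelow (fun c => frc (Nat.succ c) (fun c => frc (Nat.sub n c) (fun b =>
    mcons c c [] (fun S => mcons b b S (search n okAll r))))) (n / 2)

def chk3 (n : ℕ) : Bool :=
  anyBelow (fun c => frc (Nat.succ c) (fun c => anyBelow (fun b => frc (Nat.succ b) (fun b =>
    frc (Nat.sub n (Nat.add b c)) (fun a =>
    mcons c c [] (fun S => mcons b b S (fun S => mcons a a S (search n (okBd n) 5))))))
     (n - (c + 1)))) n

end

theorem bi_eq {α : Type} (b : Bool) (x y : α) : bi b x y = if b = true then x else y := by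
  cases b <;> rfl

theorem frc_eq {α : Type} (x : ℕ) (f : ℕ → α) : frc x f = f x := by
  cases x <;> rfl

def hgt : List (ℕ × ℕ) → ℕ → ℕ
  | [], _ => 0
  | (h, w) :: S, i => if i < w then h else hgt S (i - w)

def wid : List (ℕ × ℕ) → ℕ
  | [] => 0
  | (_, w) :: S => w + wid S

def mcP (h w : ℕ) (S : List (ℕ × ℕ)) : List (ℕ × ℕ) :=
  if w = 0 then S else
    match S with
    | [] => [(h, w)]
    | (h', v) :: S' => if h = h' then (h, w + v) :: S' else (h, w) :: (h', v) :: S'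

theorem mcons_eq (h w : ℕ) (S : List (ℕ × ℕ)) (k : List (ℕ × ℕ) → Bool) :
    mcons h w S k = k (mcP h w S) := by
  cases w with
  | zero => rfl
  | succ w =>
    cases S with
    | nil => rfl
    | cons p S' =>
      obtain ⟨h', v⟩ := p
      have e : mcons h (w + 1) ((h', v) :: S') k
        = bi (Nat.beq h h') (frc (Nat.add (w + 1) v) (fun u => k ((h, u) :: S')))
          (k ((h, w + 1) :: (h', v) :: S')) := rfl
      rw [e, bi_eq, frc_eq]
      by_cases hh : h = h'
      · simp [mcP, hh]
      · simp [mcP, hh]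

def plP (m a : ℕ) : List (ℕ × ℕ) → List (ℕ × ℕ)
  | [] => []
  | (h, w) :: S => if h = m then mcP (m + a) a (mcP m (w - a) S) else mcP h w (plP m a S)

theorem place_eq (m a : ℕ) (S : List (ℕ × ℕ)) (k : List (ℕ × ℕ) → Bool) :
    place m a S k = k (plP m a S) := by
  induction S generalizing k with
  | nil => rfl
  | cons p S ih =>
    obtain ⟨h, w⟩ := p
    have e : place m a ((h, w) :: S) k = bi (Nat.beq h m)
        (frc (Nat.sub w a) (fun u => mcons m u S
          (fun S1 => frc (Nat.add m a) (fun v => mcons v a S1 k))))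
        (place m a S (fun S1 => mcons h w S1 k)) := rfl
    rw [e, bi_eq, frc_eq, ih, mcons_eq, mcons_eq, frc_eq, mcons_eq]
    by_cases hh : h = m
    · simp [plP, hh]
    · simp [plP, hh]

theorem memb_eq (v : ℕ) (l : List ℕ) : memb v l = true ↔ v ∈ l := by
  induction l with
  | nil => simp [memb]
  | cons a l ih =>
    have e : memb v (a :: l) = bi (Nat.beq v a) true (memb v l) := rfl
    rw [e, bi_eq]
    by_cases hh : v = a <;> simp [hh, ih]

def hsP (n : ℕ) : List (ℕ × ℕ) → List ℕ
  | [] => []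
  | (h, _) :: S => if n ≤ h then hsP n S else if h ∈ hsP n S then hsP n S else h :: hsP n S

theorem hsK_eq (n : ℕ) (S : List (ℕ × ℕ)) (k : List ℕ → Bool) : hsK n S k = k (hsP n S) := by
  induction S generalizing k with
  | nil => rfl
  | cons p S ih =>
    obtain ⟨h, w⟩ := p
    have e : hsK n ((h, w) :: S) k = bi (Nat.ble n h) (hsK n S k)
      (hsK n S (fun hs => bi (memb h hs) (k hs) (k (h :: hs)))) := rfl
    rw [e, bi_eq, ih, ih, bi_eq]
    simp only [memb_eq, Nat.ble_eq, hsP]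
    split_ifs <;> rfl

theorem hsP_nodup (n : ℕ) (S : List (ℕ × ℕ)) : (hsP n S).Nodup := by
  induction S with
  | nil => simp [hsP]
  | cons p S ih =>
    obtain ⟨h, w⟩ := p
    simp only [hsP]
    split_ifs <;> simp_all

theorem mem_hsP (n : ℕ) (S : List (ℕ × ℕ)) (v : ℕ) :
    v ∈ hsP n S ↔ v < n ∧ ∃ p ∈ S, p.1 = v := by
  induction S with
  | nil => simp [hsP]
  | cons p S ih =>
    obtain ⟨h, w⟩ := p
    simp only [hsP]
    split_ifs with h1 h2
    · rw [ih]
      constructor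
      · rintro ⟨a, q, hq, rfl⟩; exact ⟨a, q, by simp [hq], rfl⟩
      · rintro ⟨a, q, hq, rfl⟩
        rcases List.mem_cons.1 hq with rfl | hq
        · simp at a; omega
        · exact ⟨a, q, hq, rfl⟩
    · rw [ih]
      constructor
      · rintro ⟨a, q, hq, rfl⟩; exact ⟨a, q, by simp [hq], rfl⟩
      · rintro ⟨a, q, hq, rfl⟩
        rcases List.mem_cons.1 hq with rfl | hq
        · exact ih.1 h2
        · exact ⟨a, q, hq, rfl⟩
    · rw [List.mem_cons, ih]
      constructor
      · rintro (rfl | ⟨a, q, hq, rfl⟩)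
        · exact ⟨by omega, (v, w), by simp, rfl⟩
        · exact ⟨a, q, by simp [hq], rfl⟩
      · rintro ⟨a, q, hq, rfl⟩
        rcases List.mem_cons.1 hq with rfl | hq
        · left; rfl
        · right; exact ⟨a, q, hq, rfl⟩

theorem lmin_spec (l : List ℕ) (v : ℕ) :
    lmin l v ≤ v ∧ (∀ u ∈ l, lmin l v ≤ u) ∧ (lmin l v = v ∨ lmin l v ∈ l) := by
  induction l generalizing v with
  | nil => simp [lmin]
  | cons a l ih =>
    have e : lmin (a :: l) v = bi (Nat.ble a v) (lmin l a) (lmin l v) := rfl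
    rw [e, bi_eq]
    simp only [Nat.ble_eq]
    split_ifs with h
    · obtain ⟨h1, h2, h3⟩ := ih a
      refine ⟨by omega, ?_, ?_⟩
      · intro u hu
        rcases List.mem_cons.1 hu with rfl | hu
        · exact h1
        · exact h2 u hu
      · right; rcases h3 with h3 | h3 <;> simp [h3]
    · obtain ⟨h1, h2, h3⟩ := ih v
      refine ⟨by omega, ?_, ?_⟩
      · intro u hu
        rcases List.mem_cons.1 hu with rfl | hu
        · omega
        · exact h2 u hu
      · rcases h3 with h3 | h3 <;> simp [h3]

theorem len_eq (l : List ℕ) : len l = l.length := by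
  induction l with
  | nil => rfl
  | cons a l ih =>
    have e : len (a :: l) = Nat.succ (len l) := rfl
    rw [e, ih]; simp

theorem runK_eq (m w : ℕ) (L R : List (ℕ × ℕ)) (hL : ∀ p ∈ L, p.1 ≠ m) (x : ℕ)
    (k : ℕ → ℕ → Bool) : runK m (L ++ (m, w) :: R) x k = k (x + wid L) w := by
  induction L generalizing x with
  | nil =>
    have e : runK m ((m, w) :: R) x k
      = bi (Nat.beq m m) (k x w) (frc (Nat.add x w) (fun x' => runK m R x' k)) := rfl
    simp only [List.nil_append]
    rw [e, bi_eq]; simp [wid]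
  | cons p L ih =>
    obtain ⟨h, v⟩ := p
    have hh : h ≠ m := hL (h, v) (by simp)
    have e : runK m ((h, v) :: (L ++ (m, w) :: R)) x k
      = bi (Nat.beq h m) (k x v)
        (frc (Nat.add x v) (fun x' => runK m (L ++ (m, w) :: R) x' k)) := rfl
    simp only [List.cons_append]
    rw [e, bi_eq, frc_eq, ih (fun p hp => hL p (by simp [hp]))]
    simp [wid, hh, Nat.add_assoc]

theorem anyBelow_true (f : ℕ → Bool) (k j : ℕ) (hj : j < k) (h : f j = true) :
    anyBelow f k = true := by
  induction k with
  | zero => omega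
  | succ k ih =>
    have e : anyBelow f (k + 1) = bi (f k) true (anyBelow f k) := rfl
    rw [e, bi_eq]
    by_cases hk : j = k
    · subst hk; simp [h]
    · rw [ih (by omega)]; simp

theorem anyL_true (f : ℕ → Bool) (l : List ℕ) (j : ℕ) (hj : j ∈ l) (h : f j = true) :
    anyL f l = true := by
  induction l with
  | nil => simp at hj
  | cons a l ih =>
    have e : anyL f (a :: l) = bi (f a) true (anyL f l) := rfl
    rw [e, bi_eq]
    rcases List.mem_cons.1 hj with rfl | hj
    · simp [h]
    · rw [ih hj]; simp

theorem hgt_append (L R : List (ℕ × ℕ)) (i : ℕ) :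
    hgt (L ++ R) i = if i < wid L then hgt L i else hgt R (i - wid L) := by
  induction L generalizing i with
  | nil => simp [wid]
  | cons p L ih =>
    obtain ⟨h, w⟩ := p
    simp only [List.cons_append, hgt, wid, ih]
    by_cases h1 : i < w
    · simp [h1, show i < w + wid L by omega]
    · by_cases h2 : i < w + wid L
      · simp [h1, h2, show i - w < wid L by omega]
      · simp [h1, h2, show ¬ (i - w < wid L) by omega, Nat.sub_sub]

theorem wid_append (L R : List (ℕ × ℕ)) : wid (L ++ R) = wid L + wid R := by
  induction L with
  | nil => simp [wid]
  | cons p L ih => simp [wid, ih, Nat.add_assoc]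

theorem hgt_mem (S : List (ℕ × ℕ)) (i : ℕ) (hi : i < wid S) : ∃ p ∈ S, p.1 = hgt S i := by
  induction S generalizing i with
  | nil => simp [wid] at hi
  | cons p S ih =>
    obtain ⟨h, w⟩ := p
    simp only [hgt, wid] at *
    split_ifs with h1
    · exact ⟨(h, w), by simp, rfl⟩
    · obtain ⟨q, hq, e⟩ := ih (i - w) (by omega)
      exact ⟨q, by simp [hq], e⟩

theorem exists_hgt (S : List (ℕ × ℕ)) (hpos : ∀ p ∈ S, 0 < p.2) (p : ℕ × ℕ) (hp : p ∈ S) :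
    ∃ i < wid S, hgt S i = p.1 := by
  induction S with
  | nil => simp at hp
  | cons q S ih =>
    obtain ⟨h, w⟩ := q
    have hw : 0 < w := hpos (h, w) (by simp)
    rcases List.mem_cons.1 hp with rfl | hp
    · exact ⟨0, by simp [wid]; omega, by simp [hgt, hw]⟩
    · obtain ⟨i, hi, e⟩ := ih (fun p hp => hpos p (by simp [hp])) hp
      refine ⟨w + i, by simp [wid]; omega, ?_⟩
      simp [hgt, e]

theorem hgt_mcP (h w : ℕ) (S : List (ℕ × ℕ)) (i : ℕ) :
    hgt (mcP h w S) i = if i < w then h else hgt S (i - w) := by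
  unfold mcP
  split_ifs with h0 h1 h1
  · omega
  · simp [h0]
  · cases S with
    | nil => simp [hgt, h1]
    | cons p S =>
      obtain ⟨h', v⟩ := p
      simp only []
      split_ifs with h2
      · simp [hgt, show i < w + v by omega]
      · simp [hgt, h1]
  · cases S with
    | nil => simp [hgt, h1]
    | cons p S =>
      obtain ⟨h', v⟩ := p
      simp only []
      split_ifs with h2
      · subst h2
        by_cases h3 : i < w + v
        · simp [hgt, h3, show i - w < v by omega]
        · simp [hgt, h3, show ¬ (i - w < v) by omega, Nat.sub_sub]
      · simp [hgt, h1]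

theorem wid_mcP (h w : ℕ) (S : List (ℕ × ℕ)) : wid (mcP h w S) = w + wid S := by
  unfold mcP
  split_ifs with h0
  · simp [h0]
  · cases S with
    | nil => simp [wid]
    | cons p S =>
      obtain ⟨h', v⟩ := p
      simp only []
      split_ifs with h2 <;> simp [wid]
      omega

def Good : List (ℕ × ℕ) → Prop
  | [] => True
  | (h, w) :: S => 0 < w ∧ (∀ p ∈ S.head?, p.1 ≠ h) ∧ Good S

theorem Good.pos {S : List (ℕ × ℕ)} (hS : Good S) : ∀ p ∈ S, 0 < p.2 := by
  induction S with
  | nil => simp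
  | cons q S ih =>
    obtain ⟨h, w⟩ := q
    intro p hp
    rcases List.mem_cons.1 hp with rfl | hp
    · exact hS.1
    · exact ih hS.2.2 p hp

theorem good_mcP (h w : ℕ) (S : List (ℕ × ℕ)) (hS : Good S) : Good (mcP h w S) := by
  unfold mcP
  split_ifs with h0
  · exact hS
  · cases S with
    | nil => simp [Good]; omega
    | cons p S =>
      obtain ⟨h', v⟩ := p
      simp only []
      split_ifs with h2
      · subst h2
        exact ⟨by omega, hS.2.1, hS.2.2⟩
      · refine ⟨by omega, ?_, hS⟩
        simp; exact fun e => h2 e.symm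

theorem good_plP (m a : ℕ) (S : List (ℕ × ℕ)) (hS : Good S) : Good (plP m a S) := by
  induction S with
  | nil => trivial
  | cons p S ih =>
    obtain ⟨h, w⟩ := p
    simp only [plP]
    split_ifs
    · exact good_mcP _ _ _ (good_mcP _ _ _ hS.2.2)
    · exact good_mcP _ _ _ (ih hS.2.2)

theorem Good.right {L R : List (ℕ × ℕ)} (hS : Good (L ++ R)) : Good R := by
  induction L with
  | nil => exact hS
  | cons p L ih => exact ih hS.2.2

theorem wid_plP (m a w : ℕ) (L R : List (ℕ × ℕ)) (hL : ∀ p ∈ L, p.1 ≠ m) (ha : a ≤ w) :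
    wid (plP m a (L ++ (m, w) :: R)) = wid (L ++ (m, w) :: R) := by
  induction L with
  | nil => simp [plP, wid_mcP, wid]; omega
  | cons p L ih =>
    obtain ⟨h, v⟩ := p
    have hh : h ≠ m := hL (h, v) (by simp)
    simp [plP, hh, wid_mcP, wid, ih (fun p hp => hL p (by simp [hp]))]

theorem hgt_plP (m a w : ℕ) (L R : List (ℕ × ℕ)) (hL : ∀ p ∈ L, p.1 ≠ m) (ha : a ≤ w) (i : ℕ) :
    hgt (plP m a (L ++ (m, w) :: R)) i =
      if wid L ≤ i ∧ i < wid L + a then m + a else hgt (L ++ (m, w) :: R) i := by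
  induction L generalizing i with
  | nil =>
    simp only [List.nil_append, plP, if_true, hgt_mcP, wid, hgt]
    by_cases h1 : i < a
    · simp [h1]
    · by_cases h2 : i < w
      · simp [h1, h2, show i - a < w - a by omega]
      · simp [h1, h2, show ¬ (i - a < w - a) by omega, show i - a - (w - a) = i - w by omega]
  | cons p L ih =>
    obtain ⟨h, v⟩ := p
    have hh : h ≠ m := hL (h, v) (by simp)
    simp only [List.cons_append, plP, hh, if_false, hgt_mcP,
      ih (fun p hp => hL p (by simp [hp])), wid, hgt]
    by_cases h1 : i < v
    · simp [h1, show ¬ (v + wid L ≤ i) by omega]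
    · simp only [h1, if_false]
      have : (wid L ≤ i - v ∧ i - v < wid L + a) ↔ (v + wid L ≤ i ∧ i < v + wid L + a) := by omega
      simp only [this]

theorem split_first (m : ℕ) (S : List (ℕ × ℕ)) (h : ∃ p ∈ S, p.1 = m) :
    ∃ L w R, S = L ++ (m, w) :: R ∧ ∀ p ∈ L, p.1 ≠ m := by
  induction S with
  | nil => simp at h
  | cons p S ih =>
    obtain ⟨h', v⟩ := p
    by_cases hh : h' = m
    · exact ⟨[], v, S, by simp [hh], by simp⟩
    · obtain ⟨q, hq, e⟩ := h
      rcases List.mem_cons.1 hq with rfl | hq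
      · exact absurd e hh
      · obtain ⟨L, w, R, e, hL⟩ := ih ⟨q, hq, e⟩
        refine ⟨(h', v) :: L, w, R, by simp [e], ?_⟩
        intro p hp
        rcases List.mem_cons.1 hp with rfl | hp
        · exact hh
        · exact hL p hp

abbrev Sq := ℕ × ℕ × ℕ

def Cov (t : Sq) (i j : ℕ) : Prop :=
  t.1 ≤ i ∧ i < t.1 + t.2.2 ∧ t.2.1 ≤ j ∧ j < t.2.1 + t.2.2

structure InvH (n : ℕ) (H : ℕ → ℕ) (U : Finset Sq) : Prop where
  sq : ∀ t ∈ U, 1 ≤ t.2.2 ∧ t.1 + t.2.2 ≤ n ∧ t.2.1 + t.2.2 ≤ n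
  above : ∀ t ∈ U, ∀ i, t.1 ≤ i → i < t.1 + t.2.2 → H i ≤ t.2.1
  cov : ∀ i j, i < n → j < n → H i ≤ j → ∃ t ∈ U, Cov t i j
  disj : ∀ t ∈ U, ∀ t' ∈ U, ∀ i j, Cov t i j → Cov t' i j → t = t'

theorem InvH.congr {n : ℕ} {H H' : ℕ → ℕ} {U : Finset Sq} (hI : InvH n H U)
    (h : ∀ i < n, H' i = H i) : InvH n H' U where
  sq := hI.sq
  above t ht i h1 h2 := by
    have := hI.sq t ht
    rw [h i (by omega)]; exact hI.above t ht i h1 h2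
  cov i j hi hj hh := hI.cov i j hi hj (by rw [← h i hi]; exact hh)
  disj := hI.disj

theorem InvH.exists_y {n : ℕ} {H : ℕ → ℕ} {U : Finset Sq} (hI : InvH n H U)
    (i : ℕ) (hi : i < n) (hH : H i < n) : ∃ t ∈ U, t.2.1 = H i ∧ Cov t i (H i) := by
  obtain ⟨t, ht, hc⟩ := hI.cov i (H i) hi hH le_rfl
  have h1 := hI.above t ht i hc.1 hc.2.1
  exact ⟨t, ht, le_antisymm hc.2.2.1 h1, hc⟩

theorem InvH.lb {n : ℕ} {H : ℕ → ℕ} {U : Finset Sq} (hI : InvH n H U) (l : List ℕ)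
    (hl : l.Nodup) (hw : ∀ v ∈ l, v < n ∧ ∃ i < n, H i = v) : l.length ≤ U.card := by
  rw [← List.toFinset_card_of_nodup hl]
  refine le_trans (Finset.card_le_card ?_) (Finset.card_image_le (s := U) (f := fun t => t.2.1))
  intro v hv
  obtain ⟨h1, i, hi, e⟩ := hw v (by simpa using hv)
  obtain ⟨t, ht, hy, _⟩ := hI.exists_y i hi (by omega)
  exact Finset.mem_image.2 ⟨t, ht, by simp [hy, e]⟩

def upd (H : ℕ → ℕ) (x m a : ℕ) : ℕ → ℕ := fun i => if x ≤ i ∧ i < x + a then m + a else H i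

theorem InvH.step {n : ℕ} {H : ℕ → ℕ} {U : Finset Sq} (hI : InvH n H U) (x w m : ℕ)
    (hw : 0 < w) (hxw : x + w ≤ n) (hm : m < n) (hH : ∀ i, x ≤ i → i < x + w → H i = m)
    (hl : x = 0 ∨ m < H (x - 1)) (hr : x + w = n ∨ m < H (x + w)) :
    ∃ a, 1 ≤ a ∧ a ≤ w ∧ m + a ≤ n ∧ (x, m, a) ∈ U ∧
      InvH n (upd H x m a) (U.erase (x, m, a)) := by
  obtain ⟨t, ht, hy, hc⟩ := hI.exists_y x (by omega) (by rw [hH x le_rfl (by omega)]; exact hm)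
  rw [hH x le_rfl (by omega)] at hy hc
  obtain ⟨tx, ty, a⟩ := t
  have hsq := hI.sq _ ht
  have hab := hI.above _ ht
  simp only [Cov] at hsq hab hy hc
  subst hy
  have htx : tx = x := by
    by_contra hne
    have := hab (x - 1) (by omega) (by omega)
    omega
  subst htx
  have haw : a ≤ w := by
    by_contra hne
    have := hab (tx + w) (by omega) (by omega)
    omega
  refine ⟨a, by omega, haw, by omega, ht, ?_⟩
  constructor
  · intro t' ht'
    exact hI.sq t' (Finset.mem_of_mem_erase ht')
  · intro t' ht' i h1 h2
    have ht'U := Finset.mem_of_mem_erase ht'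
    have hab' := hI.above t' ht'U i h1 h2
    have hs' := hI.sq t' ht'U
    unfold upd
    split_ifs with hi
    · by_contra hlt
      rw [hH i hi.1 (by omega)] at hab'
      have := hI.disj _ ht _ ht'U i t'.2.1 ⟨hi.1, hi.2, hab', by simp; omega⟩
        ⟨h1, h2, le_rfl, by omega⟩
      exact (Finset.ne_of_mem_erase ht') this.symm
    · exact hab'
  · intro i j hi hj hh
    have hle : H i ≤ j := by
      unfold upd at hh
      split_ifs at hh with h1
      · rw [hH i h1.1 (by omega)]; omega
      · exact hh
    obtain ⟨t', ht', hc'⟩ := hI.cov i j hi hj hle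
    refine ⟨t', Finset.mem_erase.2 ⟨?_, ht'⟩, hc'⟩
    rintro rfl
    simp only [Cov] at hc'
    rw [upd, if_pos ⟨hc'.1, hc'.2.1⟩] at hh
    omega
  · intro t1 h1 t2 h2
    exact hI.disj _ (Finset.mem_of_mem_erase h1) _ (Finset.mem_of_mem_erase h2)

theorem InvH.cand {n : ℕ} {H : ℕ → ℕ} {U : Finset Sq} (hI : InvH n H U) (x w m a r : ℕ)
    (hxw : x + w ≤ n) (hm : m < n) (hH : ∀ i, x ≤ i → i < x + w → H i = m)
    (hr : x + w = n ∨ m < H (x + w))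
    (ha : 1 ≤ a) (haw : a < w) (hman : m + a ≤ n) (htU : (x, m, a) ∈ U)
    (hI' : InvH n (upd H x m a) (U.erase (x, m, a))) (hs : List ℕ) (hnd : hs.Nodup)
    (hwit : ∀ v ∈ hs, v < n ∧ ∃ i < n, H i = v) (hmhs : m ∈ hs) (hcard : U.card ≤ r + 1) :
    hs.length ≤ r ∧ (r ≤ hs.length → m + a ∈ n :: hs) ∧
      (r ≤ hs.length + 1 → m + a ∈ n :: hs ∨ m + (w - a) ∈ n :: hs ∨ a + a = w) := by
  have hc' : (U.erase (x, m, a)).card ≤ r := by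
    rw [Finset.card_erase_of_mem htU]; omega
  have hwit' : ∀ v ∈ hs, v < n ∧ ∃ i < n, upd H x m a i = v := by
    intro v hv
    obtain ⟨h1, i, hi, e⟩ := hwit v hv
    refine ⟨h1, ?_⟩
    by_cases hvm : v = m
    · subst hvm
      refine ⟨x + a, by omega, ?_⟩
      rw [upd, if_neg (by omega)]
      exact hH _ (by omega) (by omega)
    · refine ⟨i, hi, ?_⟩
      rw [upd, if_neg]
      · exact e
      · intro hh
        have := hH i hh.1 (by omega)
        omega
  have hwit1 : m + a < n → ∃ i < n, upd H x m a i = m + a := fun _ =>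
    ⟨x, by omega, by rw [upd, if_pos (by omega)]⟩
  have hlen := hI'.lb hs hnd hwit'
  have hlen1 : m + a ∉ n :: hs → hs.length + 1 ≤ r := by
    intro hn
    simp only [List.mem_cons, not_or] at hn
    have := hI'.lb ((m + a) :: hs) (List.nodup_cons.2 ⟨hn.2, hnd⟩) (by
      intro v hv
      rcases List.mem_cons.1 hv with rfl | hv
      · exact ⟨by omega, hwit1 (by omega)⟩
      · exact hwit' v hv)
    simp at this
    omega
  refine ⟨by omega, ?_, ?_⟩
  · intro h1
    by_contra hn
    have := hlen1 hn
    omega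
  · intro h1
    by_contra hn
    push Not at hn
    obtain ⟨hn1, hn2, hn3⟩ := hn
    simp only [List.mem_cons, not_or] at hn1 hn2
    obtain ⟨b, hb1, hbw, hmb, hbU, hI2⟩ := hI'.step (x + a) (w - a) m (by omega) (by omega) hm
      (by
        intro i h1 h2
        rw [upd, if_neg (by omega)]
        exact hH i (by omega) (by omega))
      (by
        right
        rw [upd, if_pos (by omega)]; omega)
      (by
        rw [show x + a + (w - a) = x + w by omega]
        rcases hr with hr | hr
        · left; exact hr
        · right; rw [upd, if_neg (by omega)]; exact hr)
    have hc2 : ((U.erase (x, m, a)).erase (x + a, m, b)).card ≤ r - 1 := by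
      rw [Finset.card_erase_of_mem hbU]; omega
    have hother : ∀ v ∈ hs, v ≠ m → v < n ∧ ∃ i < n, upd (upd H x m a) (x + a) m b i = v := by
      intro v hv hvm
      obtain ⟨h1, i, hi, e⟩ := hwit v hv
      refine ⟨h1, i, hi, ?_⟩
      have hni : ¬ (x ≤ i ∧ i < x + w) := fun hh => hvm (by rw [← e, hH i hh.1 hh.2])
      rw [upd, if_neg (by omega), upd, if_neg (by omega)]; exact e
    have hA : m + a < n ∧ ∃ i < n, upd (upd H x m a) (x + a) m b i = m + a :=
      ⟨by omega, x, by omega, by rw [upd, if_neg (by omega), upd, if_pos (by omega)]⟩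
    by_cases hb : b = w - a
    · have hB : m + b < n ∧ ∃ i < n, upd (upd H x m a) (x + a) m b i = m + b :=
        ⟨by omega, x + a, by omega, by rw [upd, if_pos (by omega)]⟩
      have := hI2.lb ((m + a) :: (m + b) :: hs.erase m) (by
        refine List.nodup_cons.2 ⟨?_, List.nodup_cons.2 ⟨?_, hnd.erase m⟩⟩
        · simp only [List.mem_cons, not_or]
          exact ⟨by omega, fun h => hn1.2 (List.mem_of_mem_erase h)⟩
        · intro h
          exact hn2.2 (by rw [← hb]; exact List.mem_of_mem_erase h)) (by
        intro v hv
        rcases List.mem_cons.1 hv with rfl | hv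
        · exact hA
        rcases List.mem_cons.1 hv with rfl | hv
        · exact hB
        · exact hother v (List.mem_of_mem_erase hv) ((hnd.mem_erase_iff.1 hv).1))
      simp only [List.length_cons, List.length_erase_of_mem hmhs] at this
      have : 0 < hs.length := List.length_pos_of_mem hmhs
      omega
    · have := hI2.lb ((m + a) :: hs) (List.nodup_cons.2 ⟨hn1.2, hnd⟩) (by
        intro v hv
        rcases List.mem_cons.1 hv with rfl | hv
        · exact hA
        · by_cases hvm : v = m
          · subst hvm; clear hA hwit1 hwit' hother
            refine ⟨hm, x + w - 1, by omega, ?_⟩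
            rw [upd, if_neg (by omega), upd, if_neg (by omega)]
            exact hH _ (by omega) (by omega)
          · exact hother v hv hvm)
      simp only [List.length_cons] at this
      omega

structure SkyInv (n : ℕ) (S : List (ℕ × ℕ)) (U : Finset Sq) : Prop where
  good : Good S
  wd : wid S = n
  inv : InvH n (hgt S) U

theorem place_inv {n : ℕ} {L R : List (ℕ × ℕ)} {U U' : Finset Sq} {m w a : ℕ}
    (hI : SkyInv n (L ++ (m, w) :: R) U) (hL : ∀ p ∈ L, p.1 ≠ m) (ha : a ≤ w)
    (h : InvH n (upd (hgt (L ++ (m, w) :: R)) (wid L) m a) U') :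
    SkyInv n (plP m a (L ++ (m, w) :: R)) U' where
  good := good_plP _ _ _ hI.good
  wd := by rw [wid_plP _ _ _ _ _ hL ha, hI.wd]
  inv := h.congr (fun i _ => by rw [hgt_plP _ _ _ _ _ hL ha]; rfl)

/-- geometric facts about the first lowest run -/
theorem SkyInv.run {n : ℕ} {L R : List (ℕ × ℕ)} {U : Finset Sq} {m w : ℕ}
    (hI : SkyInv n (L ++ (m, w) :: R) U) (hmin : ∀ p ∈ L ++ (m, w) :: R, m ≤ p.1)
    (hL : ∀ p ∈ L, p.1 ≠ m) :
    0 < w ∧ wid L + w ≤ n ∧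
    (∀ i, wid L ≤ i → i < wid L + w → hgt (L ++ (m, w) :: R) i = m) ∧
    (wid L = 0 ∨ m < hgt (L ++ (m, w) :: R) (wid L - 1)) ∧
    (wid L + w = n ∨ m < hgt (L ++ (m, w) :: R) (wid L + w)) := by
  have hw := hI.wd
  have hg := hI.good.right
  simp only [wid_append, wid] at hw
  refine ⟨hg.1, by omega, ?_, ?_, ?_⟩
  · intro i h1 h2
    rw [hgt_append, if_neg (by omega), hgt, if_pos (by omega)]
  · by_cases h0 : wid L = 0
    · left; exact h0
    · right
      rw [hgt_append, if_pos (by omega)]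
      obtain ⟨p, hp, e⟩ := hgt_mem L (wid L - 1) (by omega)
      have := hL p hp
      have := hmin p (by simp [hp])
      omega
  · cases R with
    | nil => left; simp [wid] at hw; omega
    | cons q R =>
      right
      obtain ⟨h', v⟩ := q
      have h1 := hg.2.1 (h', v) (by simp)
      have h2 := hg.2.2.1
      have h3 := hmin (h', v) (by simp)
      rw [hgt_append, if_neg (by omega), hgt, if_neg (by omega), hgt, if_pos (by omega)]
      simp at h1 h3; omega

theorem search_sound (n : ℕ) (ok : ℕ → ℕ → ℕ → Bool) (r : ℕ) :
    ∀ (S : List (ℕ × ℕ)) (U : Finset Sq), SkyInv n S U → U.card ≤ r →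
      (∀ t ∈ U, ok t.1 t.2.1 t.2.2 = true) → search n ok r S = true := by
  induction r with
  | zero =>
    intro S U hI hc _
    have e : search n ok 0 S = hsK n S (fun hs => Nat.beq (len hs) 0) := rfl
    rw [e, hsK_eq, len_eq]
    have := hI.inv.lb (hsP n S) (hsP_nodup n S) (by
      intro v hv
      rw [mem_hsP] at hv
      obtain ⟨h1, p, hp, e⟩ := hv
      obtain ⟨i, hi, e'⟩ := exists_hgt S hI.good.pos p hp
      exact ⟨h1, i, by rw [← hI.wd]; exact hi, by rw [e', e]⟩)
    simp; 
    exact List.eq_nil_of_length_eq_zero (by omega)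
  | succ r ih =>
    intro S U hI hc hok
    have e : search n ok (r + 1) S = hsK n S (stepA n ok r (search n ok r) S) := rfl
    rw [e, hsK_eq]
    have hnd := hsP_nodup n S
    have hwit : ∀ v ∈ hsP n S, v < n ∧ ∃ i < n, hgt S i = v := by
      intro v hv
      rw [mem_hsP] at hv
      obtain ⟨h1, p, hp, e⟩ := hv
      obtain ⟨i, hi, e'⟩ := exists_hgt S hI.good.pos p hp
      exact ⟨h1, i, by rw [← hI.wd]; exact hi, by rw [e', e]⟩
    have hlb := hI.inv.lb _ hnd hwit
    have hmem := mem_hsP n S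
    generalize hsP n S = hs at *
    unfold stepA
    simp only [frc_eq, len_eq, bi_eq]
    split_ifs with h0 h1
    · rfl
    · simp only [Nat.beq_eq] at h0
      obtain ⟨hm1, hm2, hm3⟩ := lmin_spec hs n
      generalize lmin hs n = m at *
      obtain ⟨u, hu⟩ := List.exists_mem_of_length_pos (l := hs) (by omega)
      have hmn : m < n := lt_of_le_of_lt (hm2 u hu) (hwit u hu).1
      have hmhs : m ∈ hs := by
        rcases hm3 with h | h
        · omega
        · exact h
      obtain ⟨L, w, R, rfl, hL⟩ := split_first m S ((hmem m).1 hmhs).2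
      have hmin : ∀ p ∈ L ++ (m, w) :: R, m ≤ p.1 := by
        intro p hp
        by_cases hpn : p.1 < n
        · exact hm2 _ ((hmem _).2 ⟨hpn, p, hp, rfl⟩)
        · omega
      rw [runK_eq _ _ _ _ hL, Nat.zero_add]
      obtain ⟨g1, g2, g3, g4, g5⟩ := hI.run hmin hL
      obtain ⟨a, ha1, haw, hman, haU, hI'⟩ := hI.inv.step (wid L) w m g1 g2 hmn g3 g4 g5
      have htry : tryA n ok (search n ok r) (L ++ (m, w) :: R) m (wid L) a = true := by
        unfold tryA
        have h2 : ok (wid L) m a = true := hok _ haU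
        rw [place_eq, ih _ _ (place_inv hI hL haw hI')
          (by rw [Finset.card_erase_of_mem haU]; omega)
          (fun t ht => hok t (Finset.mem_of_mem_erase ht)), h2]
        simp [bi_eq, hman]
      generalize tryA n ok (search n ok r) (L ++ (m, w) :: R) m (wid L) = tr at *
      unfold stepB
      simp only [bi_eq, frc_eq]
      split_ifs with k1 k2 k3 k4 k5 k6
      · rfl
      · exfalso
        have haw' : a < w := lt_of_le_of_ne haw (by rintro rfl; exact k1 htry)
        obtain ⟨c1, c2, c3⟩ := hI.inv.cand (wid L) w m a r g2 hmn g3 g5 ha1 haw' hman haU hI' hs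
          hnd hwit hmhs hc
        simp at k2; omega
      · have haw' : a < w := lt_of_le_of_ne haw (by rintro rfl; exact k1 htry)
        obtain ⟨c1, c2, c3⟩ := hI.inv.cand (wid L) w m a r g2 hmn g3 g5 ha1 haw' hman haU hI' hs
          hnd hwit hmhs hc
        refine anyL_true _ _ (m + a) (c2 (by simpa using k3)) ?_
        simp [htry]; omega
      · rfl
      · have haw' : a < w := lt_of_le_of_ne haw (by rintro rfl; exact k1 htry)
        obtain ⟨c1, c2, c3⟩ := hI.inv.cand (wid L) w m a r g2 hmn g3 g5 ha1 haw' hman haU hI' hs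
          hnd hwit hmhs hc
        rcases c3 (by simpa using k4) with c | c | c
        · exfalso; apply k5
          refine anyL_true _ _ _ c ?_
          simp [htry]; omega
        · exfalso; apply k5
          refine anyL_true _ _ _ c ?_
          have e2 : w - (w - a) = a := by omega
          simp [e2, htry]; omega
        · have : Nat.div w 2 = a := by change w / 2 = a; omega
          rw [this]; exact htry
      · exfalso
        have haw' : a < w := lt_of_le_of_ne haw (by rintro rfl; exact k1 htry)
        obtain ⟨c1, c2, c3⟩ := hI.inv.cand (wid L) w m a r g2 hmn g3 g5 ha1 haw' hman haU hI' hs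
          hnd hwit hmhs hc
        rcases c3 (by simpa using k4) with c | c | c
        · apply k5
          refine anyL_true _ _ _ c ?_
          simp [htry]; omega
        · apply k5
          refine anyL_true _ _ _ c ?_
          have e2 : w - (w - a) = a := by omega
          simp [e2, htry]; omega
        · have : Nat.div w 2 = a := by change w / 2 = a; omega
          rw [this] at k6; apply k6; simp [c]
      · have haw' : a < w := lt_of_le_of_ne haw (by rintro rfl; exact k1 htry)
        refine anyBelow_true _ _ (a - 1) (by simp; omega) ?_
        rw [show (a - 1).succ = a by omega]; exact htry
    · exfalso; apply h1; simp; omega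

theorem tiling_inv {n : ℕ} {T : Finset Sq} (hT : IsSquaredTiling n T) :
    InvH n (fun _ => 0) T where
  sq t ht := by have := hT.1 t ht; omega
  above t _ i _ _ := Nat.zero_le _
  cov i j hi hj _ := by
    obtain ⟨t, ht, _⟩ := hT.2 i j hi hj
    exact ⟨t, ht.1, ht.2⟩
  disj t ht t' ht' i j h h' := by
    have := hT.1 t ht
    obtain ⟨t0, _, hu⟩ := hT.2 i j (by have := h.2.1; omega) (by have := h.2.2.2; omega)
    rw [hu t ⟨ht, h⟩, hu t' ⟨ht', h'⟩]

theorem bots {n : ℕ} (hn : 2 ≤ n) {T : Finset Sq} (hT : IsSquaredTiling n T) :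
    ∃ a c, 1 ≤ a ∧ 1 ≤ c ∧ a < n ∧ a + c ≤ n ∧ (0, 0, a) ∈ T ∧ (a, 0, c) ∈ T ∧
      (a, 0, c) ∈ T.erase (0, 0, a) ∧
      InvH n (upd (upd (fun _ => 0) 0 0 a) a 0 c) ((T.erase (0, 0, a)).erase (a, 0, c)) := by
  obtain ⟨a, a1, a2, a3, a4, hI⟩ := (tiling_inv hT).step 0 n 0 (by omega) (by omega) (by omega)
    (fun _ _ _ => rfl) (by simp) (by simp)
  have hsq := hT.1 _ a4
  simp only at hsq
  obtain ⟨c, c1, c2, c3, c4, hI2⟩ := hI.step a (n - a) 0 (by omega) (by omega) (by omega)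
    (fun i h1 h2 => by rw [upd, if_neg (by omega)])
    (by right; rw [upd, if_pos (by omega)]; omega) (by left; omega)
  exact ⟨a, c, a1, c1, by omega, by omega, a4, Finset.mem_of_mem_erase c4, c4, hI2⟩

theorem bots3 {n a c : ℕ} {U : Finset Sq} (ha : 1 ≤ a) (hc : 1 ≤ c) (hac : a + c < n)
    (hI : InvH n (upd (upd (fun _ => 0) 0 0 a) a 0 c) U) :
    ∃ d, 1 ≤ d ∧ a + c + d ≤ n ∧ (a + c, 0, d) ∈ U ∧
      InvH n (upd (upd (upd (fun _ => 0) 0 0 a) a 0 c) (a + c) 0 d) (U.erase (a + c, 0, d)) := by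
  obtain ⟨d, d1, d2, d3, d4, hI2⟩ := hI.step (a + c) (n - (a + c)) 0 (by omega) (by omega)
    (by omega)
    (fun i h1 h2 => by rw [upd, if_neg (by omega), upd, if_neg (by omega)])
    (by right; rw [upd, if_pos (by omega)]; omega) (by left; omega)
  exact ⟨d, d1, by omega, d4, hI2⟩

theorem bots4 {n a c d : ℕ} {U : Finset Sq} (ha : 1 ≤ a) (hc : 1 ≤ c) (hd : 1 ≤ d)
    (hac : a + c + d < n)
    (hI : InvH n (upd (upd (upd (fun _ => 0) 0 0 a) a 0 c) (a + c) 0 d) U) :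
    ∃ e, (a + c + d, 0, e) ∈ U := by
  obtain ⟨d, d1, d2, d3, d4, hI2⟩ := hI.step (a + c + d) (n - (a + c + d)) 0 (by omega) (by omega)
    (by omega)
    (fun i h1 h2 => by
      rw [upd, if_neg (by omega), upd, if_neg (by omega), upd, if_neg (by omega)])
    (by right; rw [upd, if_pos (by omega)]; omega) (by left; omega)
  exact ⟨d, d4⟩

def cB (T : Finset Sq) : ℕ := (T.filter (fun t => t.2.1 = 0)).card
def cT (n : ℕ) (T : Finset Sq) : ℕ := (T.filter (fun t => t.2.1 + t.2.2 = n)).card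
def cL (T : Finset Sq) : ℕ := (T.filter (fun t => t.1 = 0)).card
def cR (n : ℕ) (T : Finset Sq) : ℕ := (T.filter (fun t => t.1 + t.2.2 = n)).card

theorem list_le_cB {T : Finset Sq} (l : List Sq) (hl : l.Nodup)
    (h : ∀ t ∈ l, t ∈ T ∧ t.2.1 = 0) : l.length ≤ cB T := by
  rw [← List.toFinset_card_of_nodup hl]
  apply Finset.card_le_card
  intro t ht
  exact Finset.mem_filter.2 (h t (by simpa using ht))

theorem two_le_cB {n : ℕ} (hn : 2 ≤ n) {T : Finset Sq} (hT : IsSquaredTiling n T) :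
    2 ≤ cB T := by
  obtain ⟨a, c, a1, c1, h1, h2, h3, h4, -, -⟩ := bots hn hT
  refine list_le_cB [(0, 0, a), (a, 0, c)] ?_ ?_
  · simp; omega
  · simp [h3, h4]

theorem tiling_image {n : ℕ} {T : Finset Sq} (hT : IsSquaredTiling n T) (φ : Sq → Sq)
    (f g : ℕ → ℕ → ℕ)
    (hφ : ∀ t : Sq, (1 ≤ t.2.2 ∧ t.2.2 ≤ n - 1 ∧ t.1 + t.2.2 ≤ n ∧ t.2.1 + t.2.2 ≤ n) →
      (1 ≤ (φ t).2.2 ∧ (φ t).2.2 ≤ n - 1 ∧ (φ t).1 + (φ t).2.2 ≤ n ∧ (φ t).2.1 + (φ t).2.2 ≤ n))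
    (hc : ∀ i j, i < n → j < n → f i j < n ∧ g i j < n)
    (hcov : ∀ t : Sq, (1 ≤ t.2.2 ∧ t.2.2 ≤ n - 1 ∧ t.1 + t.2.2 ≤ n ∧ t.2.1 + t.2.2 ≤ n) →
      ∀ i j, i < n → j < n → (Cov (φ t) i j ↔ Cov t (f i j) (g i j))) :
    IsSquaredTiling n (T.image φ) := by
  constructor
  · intro t ht
    obtain ⟨t0, h0, rfl⟩ := Finset.mem_image.1 ht
    exact hφ _ (hT.1 t0 h0)
  · intro i j hi hj
    obtain ⟨h1, h2⟩ := hc i j hi hj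
    obtain ⟨t0, h0, hu⟩ := hT.2 _ _ h1 h2
    refine ⟨φ t0, ⟨Finset.mem_image_of_mem _ h0.1, ?_⟩, ?_⟩
    · exact (hcov t0 (hT.1 t0 h0.1) i j hi hj).2 h0.2
    · rintro t ⟨ht, hcv⟩
      obtain ⟨t1, h1, rfl⟩ := Finset.mem_image.1 ht
      rw [hu t1 ⟨h1, (hcov t1 (hT.1 t1 h1) i j hi hj).1 hcv⟩]

def tr (t : Sq) : Sq := (t.2.1, t.1, t.2.2)
def flY (n : ℕ) (t : Sq) : Sq := (t.1, n - (t.2.1 + t.2.2), t.2.2)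
def flX (n : ℕ) (t : Sq) : Sq := (n - (t.1 + t.2.2), t.2.1, t.2.2)

theorem tiling_tr {n : ℕ} {T : Finset Sq} (hT : IsSquaredTiling n T) :
    IsSquaredTiling n (T.image tr) := by
  refine tiling_image hT tr (fun _ j => j) (fun i _ => i) ?_ ?_ ?_
  · intro t ht; simp only [tr]; omega
  · intro i j hi hj; exact ⟨hj, hi⟩
  · intro t ht i j hi hj; simp only [tr, Cov]; omega

theorem tiling_flY {n : ℕ} {T : Finset Sq} (hT : IsSquaredTiling n T) :
    IsSquaredTiling n (T.image (flY n)) := by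
  refine tiling_image hT (flY n) (fun i _ => i) (fun _ j => n - 1 - j) ?_ ?_ ?_
  · intro t ht; simp only [flY]; omega
  · intro i j hi hj; exact ⟨hi, by omega⟩
  · intro t ht i j hi hj; simp only [flY, Cov]; omega

theorem tiling_flX {n : ℕ} {T : Finset Sq} (hT : IsSquaredTiling n T) :
    IsSquaredTiling n (T.image (flX n)) := by
  refine tiling_image hT (flX n) (fun i _ => n - 1 - i) (fun _ j => j) ?_ ?_ ?_
  · intro t ht; simp only [flX]; omega
  · intro i j hi hj; exact ⟨by omega, hj⟩
  · intro t ht i j hi hj; simp only [flX, Cov]; omega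

theorem filter_image_le {T : Finset Sq} (φ : Sq → Sq) (P Q : Sq → Prop) [DecidablePred P]
    [DecidablePred Q] (h : ∀ t ∈ T, P (φ t) → Q t) :
    ((T.image φ).filter P).card ≤ (T.filter Q).card := by
  refine le_trans (Finset.card_le_card ?_) (Finset.card_image_le (s := T.filter Q) (f := φ))
  intro t ht
  obtain ⟨h1, h2⟩ := Finset.mem_filter.1 ht
  obtain ⟨t0, h0, rfl⟩ := Finset.mem_image.1 h1
  exact Finset.mem_image_of_mem _ (Finset.mem_filter.2 ⟨h0, h t0 h0 h2⟩)

theorem sides_image {n : ℕ} {T : Finset Sq} (hT : IsSquaredTiling n T) :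
    cB (T.image (flY n)) ≤ cT n T ∧ cB (T.image tr) ≤ cL T ∧ cT n (T.image tr) ≤ cR n T ∧
    cB (T.image (flX n)) ≤ cB T := by
  refine ⟨?_, ?_, ?_, ?_⟩
  · apply filter_image_le
    intro t ht; have := hT.1 t ht; simp only [flY]; omega
  · apply filter_image_le
    intro t ht; simp only [tr]; omega
  · apply filter_image_le
    intro t ht; simp only [tr]; omega
  · apply filter_image_le
    intro t ht; simp only [flX]; omega

theorem corner_le {n : ℕ} {T : Finset Sq} (hT : IsSquaredTiling n T) (i j : ℕ) (P : Sq → Prop)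
    [DecidablePred P] (h : ∀ t ∈ T, P t → Cov t i j) :
    (T.filter P).card ≤ 1 := by
  rw [Finset.card_le_one]
  intro a ha b hb
  rw [Finset.mem_filter] at ha hb
  exact (tiling_inv hT).disj a ha.1 b hb.1 i j (h a ha.1 ha.2) (h b hb.1 hb.2)

def Touch (n : ℕ) (t : Sq) : Prop :=
  t.1 = 0 ∨ t.1 + t.2.2 = n ∨ t.2.1 = 0 ∨ t.2.1 + t.2.2 = n

instance (n : ℕ) : DecidablePred (Touch n) := fun _ => by unfold Touch; infer_instance

theorem side_sum {n : ℕ} {T : Finset Sq} (hn : 2 ≤ n) (hT : IsSquaredTiling n T) :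
    cB T + cT n T + cL T + cR n T ≤ (T.filter (Touch n)).card + 4 := by
  have h1 := corner_le hT 0 0 (fun t => t.1 = 0 ∧ t.2.1 = 0) (by
    intro t ht h; have := hT.1 t ht; simp only [Cov]; omega)
  have h2 := corner_le hT (n - 1) 0 (fun t => t.1 + t.2.2 = n ∧ t.2.1 = 0) (by
    intro t ht h; have := hT.1 t ht; simp only [Cov]; omega)
  have h3 := corner_le hT 0 (n - 1) (fun t => t.1 = 0 ∧ t.2.1 + t.2.2 = n) (by
    intro t ht h; have := hT.1 t ht; simp only [Cov]; omega)
  have h4 := corner_le hT (n - 1) (n - 1) (fun t => t.1 + t.2.2 = n ∧ t.2.1 + t.2.2 = n) (by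
    intro t ht h; have := hT.1 t ht; simp only [Cov]; omega)
  unfold cB cT cL cR
  have key : (∑ t ∈ T, ((((if t.2.1 = 0 then 1 else 0) + (if t.2.1 + t.2.2 = n then 1 else 0)) +
      (if t.1 = 0 then 1 else 0)) + (if t.1 + t.2.2 = n then 1 else 0))) ≤
      ∑ t ∈ T, (((((if Touch n t then 1 else 0) + (if t.1 = 0 ∧ t.2.1 = 0 then 1 else 0)) +
        (if t.1 + t.2.2 = n ∧ t.2.1 = 0 then 1 else 0)) +
        (if t.1 = 0 ∧ t.2.1 + t.2.2 = n then 1 else 0)) +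
        (if t.1 + t.2.2 = n ∧ t.2.1 + t.2.2 = n then 1 else 0)) := by
    apply Finset.sum_le_sum
    intro t ht
    have := hT.1 t ht
    unfold Touch
    by_cases e1 : t.1 = 0 <;> by_cases e2 : t.1 + t.2.2 = n <;> by_cases e3 : t.2.1 = 0 <;>
      by_cases e4 : t.2.1 + t.2.2 = n <;> simp only [e1, e2, e3, e4] <;> simp <;> omega
  have e0 : ∑ t ∈ T, (if Touch n t then 1 else 0) = (T.filter (Touch n)).card :=
    (Finset.card_filter (Touch n) T).symm
  simp only [Finset.sum_add_distrib] at key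
  rw [e0] at key
  simp only [← Finset.card_filter] at key
  omega

theorem four_le {n : ℕ} (hn : 2 ≤ n) {T : Finset Sq} (hT : IsSquaredTiling n T) :
    4 ≤ T.card := by
  have h1 := two_le_cB hn hT
  obtain ⟨a1, a2, a3, a4⟩ := sides_image hT
  have h2 := two_le_cB hn (tiling_flY hT)
  have h3 := two_le_cB hn (tiling_tr hT)
  have h4 := two_le_cB hn (tiling_flY (tiling_tr hT))
  obtain ⟨b1, b2, b3, b4⟩ := sides_image (tiling_tr hT)
  have h5 := side_sum hn hT
  have h6 := Finset.card_filter_le T (Touch n)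
  omega

theorem wlog_bot {n k : ℕ} {T : Finset Sq} (hT : IsSquaredTiling n T) (hk : T.card ≤ k)
    (h : cB T ≤ 2 ∨ cT n T ≤ 2 ∨ cL T ≤ 2 ∨ cR n T ≤ 2) :
    ∃ T', IsSquaredTiling n T' ∧ T'.card ≤ k ∧ cB T' ≤ 2 := by
  obtain ⟨a1, a2, a3, a4⟩ := sides_image hT
  obtain ⟨b1, b2, b3, b4⟩ := sides_image (tiling_tr hT)
  have c1 : (T.image tr).card ≤ T.card := Finset.card_image_le
  have c2 : (T.image (flY n)).card ≤ T.card := Finset.card_image_le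
  have c3 : ((T.image tr).image (flY n)).card ≤ (T.image tr).card := Finset.card_image_le
  rcases h with h | h | h | h
  · exact ⟨T, hT, hk, h⟩
  · exact ⟨_, tiling_flY hT, by omega, by omega⟩
  · exact ⟨_, tiling_tr hT, by omega, by omega⟩
  · exact ⟨_, tiling_flY (tiling_tr hT), by omega, by omega⟩

theorem bot2 {n : ℕ} (hn : 2 ≤ n) {T : Finset Sq} (hT : IsSquaredTiling n T) (hb : cB T ≤ 2) :
    ∃ a, 1 ≤ a ∧ a < n ∧ (0, 0, a) ∈ T ∧ (a, 0, n - a) ∈ T ∧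
      ∃ U : Finset Sq, U.card + 2 ≤ T.card ∧
        SkyInv n (mcP a a (mcP (n - a) (n - a) [])) U := by
  obtain ⟨a, c, a1, c1, h1, h2, h3, h4, h4', hI⟩ := bots hn hT
  have hac : c = n - a := by
    by_contra hne
    obtain ⟨d, d1, d2, d3, -⟩ := bots3 a1 c1 (by omega) hI
    have := list_le_cB (T := T) [(0, 0, a), (a, 0, c), (a + c, 0, d)]
      (by simp; omega)
      (by
        have := Finset.mem_of_mem_erase (Finset.mem_of_mem_erase d3)
        simp [h3, h4, this])
    simp at this
    omega
  subst hac
  refine ⟨a, a1, h1, h3, h4, _, ?_, good_mcP _ _ _ (good_mcP _ _ _ trivial), ?_,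
    hI.congr ?_⟩
  · rw [Finset.card_erase_of_mem h4', Finset.card_erase_of_mem h3]
    have := Finset.card_pos.2 ⟨_, h4'⟩
    rw [Finset.card_erase_of_mem h3] at this
    omega
  · simp only [wid_mcP, wid]; omega
  · intro i hi
    simp only [hgt_mcP, upd]
    by_cases e : i < a
    · rw [if_pos e, if_neg (by omega), if_pos (by omega)]; omega
    · rw [if_neg e, if_pos (by omega), if_pos (by omega)]; omega

theorem no2 {n k : ℕ} (hn : 2 ≤ n) {T : Finset Sq} (hT : IsSquaredTiling n T) (hb : cB T ≤ 2)
    (hk : T.card ≤ k + 2) (hchk : chk2 n k = false) : False := by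
  have core : ∀ a, 1 ≤ a → a < n → n - a ≤ n / 2 → ∀ U : Finset Sq, U.card ≤ k →
      SkyInv n (mcP a a (mcP (n - a) (n - a) [])) U → False := by
    intro a h1 h2 h3 U hU hI
    have hs := search_sound n okAll k _ U hI hU (fun _ _ => rfl)
    have : chk2 n k = true := by
      refine anyBelow_true _ _ (n - a - 1) (by omega) ?_
      simp only [frc_eq, mcons_eq]
      have e1 : Nat.succ (n - a - 1) = n - a := by omega
      have e2 : Nat.sub n (n - a) = a := by change n - (n - a) = a; omega
      rw [e1, e2]; exact hs
    rw [this] at hchk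
    exact absurd hchk (by simp)
  obtain ⟨a, h1, h2, h3, h4, U, hU, hI⟩ := bot2 hn hT hb
  by_cases hle : n - a ≤ n / 2
  · exact core a h1 h2 hle U (by omega) hI
  · have hT' := tiling_flX hT
    have c1 : (T.image (flX n)).card ≤ T.card := Finset.card_image_le
    obtain ⟨a', h1', h2', h3', h4', U', hU', hI'⟩ :=
      bot2 hn hT' (le_trans (sides_image hT).2.2.2 hb)
    have hm : ((0, 0, n - a) : Sq) ∈ T.image (flX n) := by
      refine Finset.mem_image.2 ⟨_, h4, ?_⟩
      have e0 : n - (a + (n - a)) = 0 := by omega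
      change ((n - (a + (n - a)), 0, n - a) : Sq) = (0, 0, n - a)
      rw [e0]
    have := (tiling_inv hT').disj _ h3' _ hm 0 0 (by simp [Cov]; omega) (by simp [Cov]; omega)
    have e : a' = n - a := congrArg (fun t : Sq => t.2.2) this
    exact core a' h1' h2' (by omega) U' (by omega) hI'

theorem no3 {n : ℕ} (hn : 2 ≤ n) {T : Finset Sq} (hT : IsSquaredTiling n T) (hb : cB T = 3)
    (hk : T.card ≤ 8) (htouch : ∀ t ∈ T, Touch n t) (hchk : chk3 n = false) : False := by
  obtain ⟨a, c, a1, c1, h1, h2, h3, h4, h4', hI⟩ := bots hn hT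
  have hac : a + c < n := by
    by_contra hne
    have : T.filter (fun t => t.2.1 = 0) ⊆ {(0, 0, a), (a, 0, c)} := by
      intro t ht
      obtain ⟨ht, hy⟩ := Finset.mem_filter.1 ht
      have hv := hT.1 t ht
      by_cases hx : t.1 < a
      · have := (tiling_inv hT).disj _ ht _ h3 t.1 0 (by simp only [Cov]; omega)
          (by simp only [Cov]; omega)
        simp [this]
      · have := (tiling_inv hT).disj _ ht _ h4 t.1 0 (by simp only [Cov]; omega)
          (by simp only [Cov]; omega)
        simp [this]
    have h5 := Finset.card_le_card this
    have h6 : ({(0, 0, a), (a, 0, c)} : Finset Sq).card ≤ 2 := Finset.card_le_two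
    unfold cB at hb
    omega
  obtain ⟨d, d1, d2, d3, hI3⟩ := bots3 a1 c1 hac hI
  have d3T := Finset.mem_of_mem_erase (Finset.mem_of_mem_erase d3)
  have hd : a + c + d = n := by
    by_contra hne
    obtain ⟨e, he⟩ := bots4 a1 c1 d1 (by omega) hI3
    have heT := Finset.mem_of_mem_erase (Finset.mem_of_mem_erase (Finset.mem_of_mem_erase he))
    have := list_le_cB (T := T) [(0, 0, a), (a, 0, c), (a + c, 0, d), (a + c + d, 0, e)]
      (by simp; omega) (by simp [h3, h4, d3T, heT])
    simp at this
    omega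
  have hS : SkyInv n (mcP a a (mcP c c (mcP d d [])))
      (((T.erase (0, 0, a)).erase (a, 0, c)).erase (a + c, 0, d)) := by
    refine ⟨good_mcP _ _ _ (good_mcP _ _ _ (good_mcP _ _ _ trivial)), ?_, hI3.congr ?_⟩
    · simp only [wid_mcP, wid]; omega
    · intro i hi
      simp only [hgt_mcP, upd]
      by_cases e : i < a
      · rw [if_pos e, if_neg (by omega), if_neg (by omega), if_pos (by omega)]; omega
      · by_cases e2 : i - a < c
        · rw [if_neg e, if_pos e2, if_neg (by omega), if_pos (by omega)]; omega
        · rw [if_neg e, if_neg e2, if_pos (by omega), if_pos (by omega)]; omega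
  have hs := search_sound n (okBd n) 5 _ _ hS (by
    rw [Finset.card_erase_of_mem d3, Finset.card_erase_of_mem h4', Finset.card_erase_of_mem h3]
    omega) (by
    intro t ht
    have htT := Finset.mem_of_mem_erase (Finset.mem_of_mem_erase (Finset.mem_of_mem_erase ht))
    have hne1 := Finset.ne_of_mem_erase ht
    have hne2 := Finset.ne_of_mem_erase (Finset.mem_of_mem_erase ht)
    have hne3 := Finset.ne_of_mem_erase (Finset.mem_of_mem_erase (Finset.mem_of_mem_erase ht))
    have hto := htouch t htT
    have hv := hT.1 t htT
    unfold okBd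
    simp only [bi_eq]
    by_cases x1 : t.1 = 0
    · simp [x1]
    by_cases x2 : t.1 + t.2.2 = n
    · simp [x2]
    by_cases x3 : t.2.1 + t.2.2 = n
    · simp [x3]
    exfalso
    have hy : t.2.1 = 0 := by
      unfold Touch at hto; omega
    by_cases hx : t.1 < a
    · exact hne3 ((tiling_inv hT).disj _ htT _ h3 t.1 0 (by simp only [Cov]; omega)
        (by simp only [Cov]; omega))
    by_cases hx : t.1 < a + c
    · exact hne2 ((tiling_inv hT).disj _ htT _ h4 t.1 0 (by simp only [Cov]; omega)
        (by simp only [Cov]; omega))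
    · exact hne1 ((tiling_inv hT).disj _ htT _ d3T t.1 0 (by simp only [Cov]; omega)
        (by simp only [Cov]; omega)))
  have : chk3 n = true := by
    refine anyBelow_true _ _ (d - 1) (by omega) ?_
    simp only [frc_eq, mcons_eq]
    have e1 : Nat.succ (d - 1) = d := by omega
    rw [e1]
    refine anyBelow_true _ _ (c - 1) (by omega) ?_
    have e2 : Nat.succ (c - 1) = c := by omega
    have e3 : Nat.sub n (Nat.add c d) = a := by change n - (c + d) = a; omega
    rw [e2, e3]; exact hs
  rw [this] at hchk
  exact absurd hchk (by simp)

theorem lb7 {n k : ℕ} (hn : 2 ≤ n) (hk : k ≤ 5) (hchk : chk2 n k = false) {T : Finset Sq}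
    (hT : IsSquaredTiling n T) : k + 3 ≤ T.card := by
  by_contra hlt
  have h5 := side_sum hn hT
  have h6 := Finset.card_filter_le T (Touch n)
  obtain ⟨T', hT', hc, hb⟩ := wlog_bot (k := k + 2) hT (by omega) (by omega)
  exact no2 hn hT' hb hc hchk

theorem lb8 {n : ℕ} (hn : 2 ≤ n) (hchk : chk2 n 6 = false) (hchk3 : chk3 n = false)
    {T : Finset Sq} (hT : IsSquaredTiling n T) : 9 ≤ T.card := by
  by_contra hlt
  have h5 := side_sum hn hT
  have h6 := Finset.card_filter_le T (Touch n)
  by_cases h : cB T ≤ 2 ∨ cT n T ≤ 2 ∨ cL T ≤ 2 ∨ cR n T ≤ 2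
  · obtain ⟨T', hT', hc, hb⟩ := wlog_bot (k := 8) hT (by omega) h
    exact no2 hn hT' hb hc hchk
  · refine no3 hn hT (by omega) (by omega) ?_ hchk3
    have : (T.filter (Touch n)).card = T.card := by omega
    exact Finset.card_filter_eq_iff.1 this

theorem chkA : anyBelow (fun j => chk2 (6 * j + 3) 3) 17 = false := by decide +kernel
theorem chk25 : chk2 25 5 = false := by decide +kernel
theorem chk35 : chk2 35 5 = false := by decide +kernel
theorem chk55 : chk2 55 5 = false := by decide +kernel
theorem chk65 : chk2 65 5 = false := by decide +kernel
theorem chk85 : chk2 85 5 = false := by decide +kernel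
theorem chk95 : chk2 95 5 = false := by decide +kernel
theorem chk49 : chk2 49 6 = false := by decide +kernel
theorem chk77 : chk2 77 6 = false := by decide +kernel
theorem chk91 : chk2 91 6 = false := by decide +kernel
theorem chk3_49 : chk3 49 = false := by decide +kernel
theorem chk3_77 : chk3 77 = false := by decide +kernel
theorem chk3_91 : chk3 91 = false := by decide +kernel

theorem unit_tiling (n : ℕ) (hn : 2 ≤ n) : ∃ T, IsSquaredTiling n T := by
  refine ⟨(Finset.range n ×ˢ Finset.range n).image (fun p => (p.1, p.2, 1)), ?_, ?_⟩
  · intro t ht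
    obtain ⟨p, hp, rfl⟩ := Finset.mem_image.1 ht
    simp only [Finset.mem_product, Finset.mem_range] at hp
    simp only; omega
  · intro i j hi hj
    refine ⟨(i, j, 1), ⟨Finset.mem_image.2 ⟨(i, j), by simp [hi, hj], rfl⟩, by simp⟩, ?_⟩
    rintro t ⟨ht, hc⟩
    obtain ⟨p, hp, rfl⟩ := Finset.mem_image.1 ht
    simp only at hc
    have e1 : p.1 = i := by omega
    have e2 : p.2 = j := by omega
    rw [← e1, ← e2]

theorem s_mem (n : ℕ) (hn : 2 ≤ n) : ∃ T : Finset Sq, IsSquaredTiling n T ∧ T.card = s n := by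
  obtain ⟨T, hT⟩ := unit_tiling n hn
  exact Nat.sInf_mem (s := {k | ∃ T : Finset (ℕ × ℕ × ℕ), IsSquaredTiling n T ∧ T.card = k})
    ⟨_, T, hT, rfl⟩

theorem s_le {n : ℕ} {T : Finset Sq} (hT : IsSquaredTiling n T) : s n ≤ T.card :=
  Nat.sInf_le ⟨T, hT, rfl⟩

theorem s_mul_le (p d : ℕ) (hp : 2 ≤ p) (hd : 0 < d) : s (p * d) ≤ s p := by
  obtain ⟨T, hT, hc⟩ := s_mem p hp
  have hT' : IsSquaredTiling (p * d) (T.image (fun t => (t.1 * d, t.2.1 * d, t.2.2 * d))) := by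
    constructor
    · intro t ht
      obtain ⟨t0, h0, rfl⟩ := Finset.mem_image.1 ht
      obtain ⟨a1, a2, a3, a4⟩ := hT.1 t0 h0
      simp only
      refine ⟨Nat.mul_pos a1 hd, ?_, ?_, ?_⟩
      · have : t0.2.2 * d < p * d := Nat.mul_lt_mul_of_pos_right (by omega) hd
        omega
      · rw [← Nat.add_mul]; exact Nat.mul_le_mul_right d a3
      · rw [← Nat.add_mul]; exact Nat.mul_le_mul_right d a4
    · intro i j hi hj
      have key : ∀ x h i : ℕ, (x * d ≤ i ∧ i < x * d + h * d) ↔ (x ≤ i / d ∧ i / d < x + h) := by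
        intro x h i
        rw [← Nat.add_mul, Nat.le_div_iff_mul_le hd, Nat.div_lt_iff_lt_mul hd]
      obtain ⟨t0, h0, hu⟩ := hT.2 (i / d) (j / d) ((Nat.div_lt_iff_lt_mul hd).2 hi)
        ((Nat.div_lt_iff_lt_mul hd).2 hj)
      refine ⟨_, ⟨Finset.mem_image_of_mem _ h0.1, ?_⟩, ?_⟩
      · have k1 := (key t0.1 t0.2.2 i).2 ⟨h0.2.1, h0.2.2.1⟩
        have k2 := (key t0.2.1 t0.2.2 j).2 h0.2.2.2
        exact ⟨k1.1, k1.2, k2⟩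
      · rintro t ⟨ht, hc1, hc2, hc3⟩
        obtain ⟨t1, h1, rfl⟩ := Finset.mem_image.1 ht
        have k1 := (key t1.1 t1.2.2 i).1 ⟨hc1, hc2⟩
        have k2 := (key t1.2.1 t1.2.2 j).1 hc3
        rw [hu t1 ⟨h1, k1.1, k1.2, k2⟩]
  exact le_trans (s_le hT') (le_trans Finset.card_image_le hc.le)

theorem tiling_of_check {n : ℕ} (T : Finset Sq)
    (h1 : ∀ t ∈ T, 1 ≤ t.2.2 ∧ t.2.2 ≤ n - 1 ∧ t.1 + t.2.2 ≤ n ∧ t.2.1 + t.2.2 ≤ n)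
    (h2 : ∀ i < n, ∀ j < n, (T.filter (fun t =>
      t.1 ≤ i ∧ i < t.1 + t.2.2 ∧ t.2.1 ≤ j ∧ j < t.2.1 + t.2.2)).card = 1) :
    IsSquaredTiling n T := by
  refine ⟨h1, fun i j hi hj => ?_⟩
  obtain ⟨t, ht⟩ := Finset.card_eq_one.1 (h2 i hi j hj)
  have hm : ∀ u, u ∈ T.filter (fun t =>
      t.1 ≤ i ∧ i < t.1 + t.2.2 ∧ t.2.1 ≤ j ∧ j < t.2.1 + t.2.2) ↔ u = t := by
    intro u; rw [ht]; simp
  refine ⟨t, Finset.mem_filter.1 ((hm t).2 rfl), ?_⟩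
  intro u hu
  exact (hm u).1 (Finset.mem_filter.2 hu)

theorem s2_le : s 2 ≤ 4 :=
  s_le (tiling_of_check {(0, 0, 1), (0, 1, 1), (1, 0, 1), (1, 1, 1)}
    (by decide +kernel) (by decide +kernel))

theorem s3_le : s 3 ≤ 6 :=
  s_le (tiling_of_check {(0, 0, 2), (2, 0, 1), (2, 1, 1), (0, 2, 1), (1, 2, 1), (2, 2, 1)}
    (by decide +kernel) (by decide +kernel))

theorem s5_le : s 5 ≤ 8 :=
  s_le (tiling_of_check {(0, 0, 3), (3, 0, 2), (0, 3, 2), (3, 3, 2), (3, 2, 1), (4, 2, 1),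
    (2, 3, 1), (2, 4, 1)}
    (by decide +kernel) (by decide +kernel))

theorem s7_le : s 7 ≤ 9 :=
  s_le (tiling_of_check {(0, 0, 4), (4, 0, 3), (0, 4, 3), (4, 3, 1), (3, 4, 1), (4, 4, 1),
    (5, 3, 2), (3, 5, 2), (5, 5, 2)}
    (by decide +kernel) (by decide +kernel))

theorem exists_prime_le (n : ℕ) (h2 : 2 ≤ n) (h104 : n ≤ 104) :
    ∃ p : ℕ, p.Prime ∧ p ∣ n ∧ s p ≤ s n := by
  by_cases hp : n.Prime
  · exact ⟨n, hp, dvd_rfl, le_rfl⟩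
  have hpp : n.minFac.Prime := Nat.minFac_prime (by omega)
  refine ⟨n.minFac, hpp, Nat.minFac_dvd n, ?_⟩
  have hsq := Nat.minFac_sq_le_self (by omega) hp
  have hdv := Nat.minFac_dvd n
  have hmin : ∀ q, 2 ≤ q → q ∣ n → n.minFac ≤ q := fun q h1 h2 => Nat.minFac_le_of_dvd h1 h2
  obtain ⟨T, hT, hc⟩ := s_mem n h2
  generalize n.minFac = p at *
  have hp10 : p ≤ 10 := by nlinarith
  have d2 := hmin 2 (by norm_num)
  have d3 := hmin 3 (by norm_num)
  have d5 := hmin 5 (by norm_num)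
  rw [← hc]
  interval_cases p
  · exact absurd hpp (by norm_num)
  · exact absurd hpp (by norm_num)
  · exact le_trans s2_le (four_le h2 hT)
  · refine le_trans s3_le ?_
    have hn : ∃ j < 17, n = 6 * j + 3 := ⟨n / 6, by omega, by omega⟩
    obtain ⟨j, hj, rfl⟩ := hn
    refine lb7 (k := 3) h2 (by norm_num) ?_ hT
    by_contra hne
    have := anyBelow_true (fun j => chk2 (6 * j + 3) 3) 17 j hj (by simpa using hne)
    rw [chkA] at this
    exact absurd this (by simp)
  · exact absurd hpp (by norm_num)
  · refine le_trans s5_le ?_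
    have hn : n = 25 ∨ n = 35 ∨ n = 55 ∨ n = 65 ∨ n = 85 ∨ n = 95 := by omega
    refine lb7 (k := 5) h2 (by norm_num) ?_ hT
    rcases hn with rfl | rfl | rfl | rfl | rfl | rfl
    · exact chk25
    · exact chk35
    · exact chk55
    · exact chk65
    · exact chk85
    · exact chk95
  · exact absurd hpp (by norm_num)
  · refine le_trans s7_le ?_
    have hn : n = 49 ∨ n = 77 ∨ n = 91 := by omega
    rcases hn with rfl | rfl | rfl
    · exact lb8 h2 chk49 chk3_49 hT
    · exact lb8 h2 chk77 chk3_77 hT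
    · exact lb8 h2 chk91 chk3_91 hT
  · exact absurd hpp (by norm_num)
  · exact absurd hpp (by norm_num)
  · exact absurd hpp (by norm_num)

theorem s_eq_min_over_prime_divisors (n : ℕ) (h2 : 2 ≤ n) (h104 : n ≤ 104) :
    s n = sInf {k | ∃ p : ℕ, p.Prime ∧ p ∣ n ∧ s p = k} := by
  obtain ⟨p, hp, hd, hle⟩ := exists_prime_le n h2 h104
  apply le_antisymm
  · refine le_csInf ⟨_, p, hp, hd, rfl⟩ ?_
    rintro k ⟨q, hq, ⟨d, rfl⟩, rfl⟩
    exact s_mul_le q d hq.two_le (Nat.pos_of_ne_zero (by rintro rfl; simp at h2))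
  · exact le_trans (Nat.sInf_le ⟨p, hp, hd, rfl⟩) hle
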